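/- (Example 4.1, fractional closed-form solution.) Let 0 < α < 1 and define u : ℝ × [0,∞) → ℝ by u(x,t) = sin x + ∑_{k=0}^∞ t^{kα} / Γ(kα + 1). Then u(x,0) = 1 + sin x for all x, and for every x ∈ ℝ and t > 0, the Caputo time-derivative of order α of u equals ∂²u/∂x² + u, i.e. (1/Γ(1−α)) ∫_0^t (t−ξ)^{−α} · (∂u/∂ξ)(x,ξ) dξ = ∂²u/∂x² (x,t) + u(x,t). -/

import Mathlib

open MeasureTheory intervalIntegral

/-- The FRDTM series solution of Example 4.1 for fractional order `α`. -/
noncomputable def uFrac (α : ℝ) (x t : ℝ) : ℝ :=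
  Real.sin x + ∑' k : ℕ, t ^ ((k : ℝ) * α) / Real.Gamma ((k : ℝ) * α + 1)

/-- A lower bound for the Gamma function which beats every geometric growth. -/
lemma rpow_mul_exp_le_Gamma_add_one {R s : ℝ} (hR : 0 < R) (hs : 0 ≤ s) :
    R ^ s * Real.exp (-(R + 1)) ≤ Real.Gamma (s + 1) := by
  rw [Real.Gamma_eq_integral (by linarith)]
  have hint := Real.GammaIntegral_convergent (s := s + 1) (by linarith)
  have hsub : Set.Ioc R (R + 1) ⊆ Set.Ioi (0 : ℝ) := fun x hx => hR.trans hx.1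
  calc R ^ s * Real.exp (-(R + 1))
      = ∫ _ in Set.Ioc R (R + 1), R ^ s * Real.exp (-(R + 1)) := by simp
    _ ≤ ∫ x in Set.Ioc R (R + 1), Real.exp (-x) * x ^ (s + 1 - 1) := by
        refine setIntegral_mono_on (integrableOn_const (by simp)) (hint.mono_set hsub) measurableSet_Ioc ?_
        intro x hx
        rw [mul_comm, add_sub_cancel_right]
        have h1 : R ^ s ≤ x ^ s := Real.rpow_le_rpow hR.le hx.1.le hs
        have h2 : Real.exp (-(R + 1)) ≤ Real.exp (-x) :=
          Real.exp_le_exp.2 (neg_le_neg hx.2)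
        gcongr
    _ ≤ ∫ x in Set.Ioi (0 : ℝ), Real.exp (-x) * x ^ (s + 1 - 1) := by
        refine setIntegral_mono_set hint ?_ hsub.eventuallyLE
        filter_upwards [ae_restrict_mem measurableSet_Ioi] with x hx
        exact mul_nonneg (Real.exp_pos _).le (Real.rpow_nonneg (le_of_lt hx) _)

/-- The Mittag-Leffler series converges, even after multiplying its terms by their index. -/
lemma summable_natCast_mul_rpow_div_Gamma (m : ℕ) {α t : ℝ} (hα : 0 < α) (ht : 0 < t) :
    Summable fun k : ℕ => (k : ℝ) ^ m * (t ^ ((k : ℝ) * α) / Real.Gamma ((k : ℝ) * α + 1)) := by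
  set r : ℝ := (1 / 2 : ℝ) ^ α with hr
  have hr0 : 0 < r := by positivity
  have hr1 : r < 1 := Real.rpow_lt_one (by norm_num) (by norm_num) hα
  have hsum := (summable_pow_mul_geometric_of_norm_lt_one m (R := ℝ) (r := r)
    (by rwa [Real.norm_of_nonneg hr0.le])).mul_left (Real.exp (2 * t + 1))
  refine Summable.of_nonneg_of_le (fun k => ?_) (fun k => ?_) hsum
  · have : 0 < Real.Gamma ((k : ℝ) * α + 1) := Real.Gamma_pos_of_pos (by positivity)
    positivity
  · have hG : 0 < Real.Gamma ((k : ℝ) * α + 1) := Real.Gamma_pos_of_pos (by positivity)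
    have hle := rpow_mul_exp_le_Gamma_add_one (R := 2 * t) (s := k * α) (by positivity)
      (by positivity)
    have hrk : r ^ k * (2 * t) ^ ((k : ℝ) * α) = t ^ ((k : ℝ) * α) := by
      rw [hr, ← Real.rpow_natCast, ← Real.rpow_mul (by norm_num), mul_comm α,
        ← Real.mul_rpow (by norm_num) (by positivity)]
      congr 1
      ring
    have key : t ^ ((k : ℝ) * α) / Real.Gamma ((k : ℝ) * α + 1)
        ≤ Real.exp (2 * t + 1) * r ^ k := by
      rw [div_le_iff₀ hG, ← hrk]
      calc r ^ k * (2 * t) ^ ((k : ℝ) * α)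
          = Real.exp (2 * t + 1) * r ^ k
              * ((2 * t) ^ ((k : ℝ) * α) * Real.exp (-(2 * t + 1))) := by
            rw [Real.exp_neg]
            field_simp
        _ ≤ _ := by gcongr
    calc (k : ℝ) ^ m * (t ^ ((k : ℝ) * α) / Real.Gamma ((k : ℝ) * α + 1))
        ≤ (k : ℝ) ^ m * (Real.exp (2 * t + 1) * r ^ k) := by gcongr
      _ = _ := by ring

lemma summable_rpow_div_Gamma {α t : ℝ} (hα : 0 < α) (ht : 0 < t) :
    Summable fun k : ℕ => t ^ ((k : ℝ) * α) / Real.Gamma ((k : ℝ) * α + 1) := by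
  simpa using summable_natCast_mul_rpow_div_Gamma 0 hα ht

/-- Termwise differentiation of the Mittag-Leffler series. -/
lemma hasDerivAt_tsum_rpow_div_Gamma {α t : ℝ} (hα : 0 < α) (ht : 0 < t) :
    HasDerivAt (fun τ : ℝ => ∑' k : ℕ, τ ^ ((k : ℝ) * α) / Real.Gamma ((k : ℝ) * α + 1))
      (∑' n : ℕ, t ^ (((n + 1 : ℕ) : ℝ) * α - 1) / Real.Gamma (((n + 1 : ℕ) : ℝ) * α)) t := by
  set g' : ℕ → ℝ → ℝ := fun k τ =>
    ((k : ℝ) * α) * τ ^ ((k : ℝ) * α - 1) / Real.Gamma ((k : ℝ) * α + 1) with hg'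
  set u : ℕ → ℝ := fun k => (2 * α / t) *
    ((k : ℝ) ^ 1 * ((2 * t) ^ ((k : ℝ) * α) / Real.Gamma ((k : ℝ) * α + 1))) with hu
  have hus : Summable u :=
    (summable_natCast_mul_rpow_div_Gamma 1 hα (by positivity)).mul_left _
  have hmem : t ∈ Set.Ioo (t / 2) (2 * t) := ⟨by linarith, by linarith⟩
  have hbound : ∀ k y, y ∈ Set.Ioo (t / 2) (2 * t) → ‖g' k y‖ ≤ u k := by
    intro k y hy
    have hy0 : 0 < y := by linarith [hy.1]
    have hG : 0 < Real.Gamma ((k : ℝ) * α + 1) := Real.Gamma_pos_of_pos (by positivity)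
    rw [Real.norm_of_nonneg (by simp only [hg']; positivity)]
    simp only [hg', hu]
    rw [Real.rpow_sub_one hy0.ne']
    have h1 : y ^ ((k : ℝ) * α) ≤ (2 * t) ^ ((k : ℝ) * α) :=
      Real.rpow_le_rpow hy0.le hy.2.le (by positivity)
    have h2 : y ^ ((k : ℝ) * α) / y ≤ (2 * t) ^ ((k : ℝ) * α) / (t / 2) := by
      have := hy.1.le
      gcongr
    calc (k : ℝ) * α * (y ^ ((k : ℝ) * α) / y) / Real.Gamma ((k : ℝ) * α + 1)
        ≤ (k : ℝ) * α * ((2 * t) ^ ((k : ℝ) * α) / (t / 2)) / Real.Gamma ((k : ℝ) * α + 1) := by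
          gcongr
      _ = _ := by
          field_simp
  have hd := hasDerivAt_tsum_of_isPreconnected (t := Set.Ioo (t / 2) (2 * t)) hus isOpen_Ioo
    isPreconnected_Ioo
    (g := fun (k : ℕ) (τ : ℝ) => τ ^ ((k : ℝ) * α) / Real.Gamma ((k : ℝ) * α + 1)) (g' := g')
    (fun k y hy => (Real.hasDerivAt_rpow_const
      (Or.inl (show y ≠ 0 by linarith [hy.1]))).div_const _) hbound hmem
    (summable_rpow_div_Gamma hα ht) hmem
  have hs : Summable fun k => g' k t := .of_norm_bounded hus fun k => hbound k t hmem
  refine hd.congr_deriv ?_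
  rw [hs.tsum_eq_zero_add]
  simp only [hg', Nat.cast_zero, zero_mul, zero_div, zero_add]
  refine tsum_congr fun n => ?_
  have hn : 0 < ((n + 1 : ℕ) : ℝ) * α := by positivity
  rw [Real.Gamma_add_one hn.ne', mul_div_mul_left _ _ hn.ne']

/-- The real Beta integral on `[0, a]`. -/
lemma integral_rpow_mul_sub_rpow {s r a : ℝ} (hs : 0 < s) (hr : 0 < r) (ha : 0 < a) :
    ∫ x in (0 : ℝ)..a, x ^ (s - 1) * (a - x) ^ (r - 1)
      = a ^ (s + r - 1) * (Real.Gamma s * Real.Gamma r / Real.Gamma (s + r)) := by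
  apply Complex.ofReal_injective
  rw [← intervalIntegral.integral_ofReal]
  have h := Complex.betaIntegral_scaled s r ha
  rw [Complex.betaIntegral_eq_Gamma_mul_div _ _ (by simpa) (by simpa), ← Complex.ofReal_add,
    Complex.Gamma_ofReal, Complex.Gamma_ofReal, Complex.Gamma_ofReal] at h
  push_cast [Complex.ofReal_cpow ha.le] at h ⊢
  rw [← h]
  refine intervalIntegral.integral_congr fun x hx => ?_
  rw [Set.uIcc_of_le ha.le] at hx
  simp only [Complex.ofReal_cpow hx.1, Complex.ofReal_cpow (sub_nonneg.2 hx.2)]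
  push_cast
  rfl

/-- The Caputo derivative of the Mittag-Leffler function, before normalisation. -/
lemma integral_sub_rpow_mul_tsum {α t : ℝ} (hα₁ : 0 < α) (hα₂ : α < 1) (ht : 0 < t) :
    ∫ ξ in (0 : ℝ)..t, (t - ξ) ^ (-α) *
        ∑' n : ℕ, ξ ^ (((n + 1 : ℕ) : ℝ) * α - 1) / Real.Gamma (((n + 1 : ℕ) : ℝ) * α)
      = Real.Gamma (1 - α) *
        ∑' n : ℕ, t ^ ((n : ℝ) * α) / Real.Gamma ((n : ℝ) * α + 1) := by
  set F : ℕ → ℝ → ℝ := fun n ξ => (t - ξ) ^ (-α) *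
    (ξ ^ (((n + 1 : ℕ) : ℝ) * α - 1) / Real.Gamma (((n + 1 : ℕ) : ℝ) * α)) with hF
  have hGpos : ∀ n : ℕ, 0 < Real.Gamma (((n + 1 : ℕ) : ℝ) * α) := fun n =>
    Real.Gamma_pos_of_pos (by positivity)
  have hG1 : 0 < Real.Gamma (1 - α) := Real.Gamma_pos_of_pos (by linarith)
  have hval : ∀ n, ∫ ξ in (0 : ℝ)..t, F n ξ
      = Real.Gamma (1 - α) * (t ^ ((n : ℝ) * α) / Real.Gamma ((n : ℝ) * α + 1)) := by
    intro n
    have h := integral_rpow_mul_sub_rpow (s := ((n + 1 : ℕ) : ℝ) * α) (r := 1 - α)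
      (by positivity) (by linarith) ht
    have e1 : ((n + 1 : ℕ) : ℝ) * α + (1 - α) = n * α + 1 := by push_cast; ring
    rw [e1, add_sub_cancel_right] at h
    have : ∀ ξ, F n ξ = (ξ ^ (((n + 1 : ℕ) : ℝ) * α - 1) * (t - ξ) ^ (1 - α - 1))
        / Real.Gamma (((n + 1 : ℕ) : ℝ) * α) := by
      intro ξ
      rw [show 1 - α - 1 = -α by ring]
      simp only [hF]
      ring
    simp only [this]
    rw [intervalIntegral.integral_div, h]
    have := (hGpos n).ne'
    field_simp
  have hii : ∀ n, IntervalIntegrable (F n) volume 0 t := by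
    intro n
    by_contra hcon
    have h0 := (hval n).symm.trans (intervalIntegral.integral_undef hcon)
    have : 0 < Real.Gamma ((n : ℝ) * α + 1) := Real.Gamma_pos_of_pos (by positivity)
    have : 0 < Real.Gamma (1 - α) * (t ^ ((n : ℝ) * α) / Real.Gamma ((n : ℝ) * α + 1)) := by
      positivity
    exact this.ne' h0
  have hnn : ∀ n, ∀ ξ ∈ Set.Ioc 0 t, ‖F n ξ‖ = F n ξ := fun n ξ hξ =>
    Real.norm_of_nonneg (mul_nonneg (Real.rpow_nonneg (sub_nonneg.2 hξ.2) _)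
      (div_nonneg (Real.rpow_nonneg hξ.1.le _) (hGpos n).le))
  simp only [intervalIntegral.integral_of_le ht.le] at hval ⊢
  have hsum := hasSum_integral_of_summable_integral_norm (μ := volume.restrict (Set.Ioc 0 t))
    (F := F) (fun n => (intervalIntegrable_iff_integrableOn_Ioc_of_le ht.le).1 (hii n)) (by
      simp only [setIntegral_congr_fun measurableSet_Ioc (hnn _), hval]
      exact (summable_rpow_div_Gamma hα₁ ht).mul_left _)
  rw [← tsum_mul_left, ← tsum_congr hval, hsum.tsum_eq]
  simp only [hF, tsum_mul_left]

theorem example41_fractional_solution (α : ℝ) (hα₁ : 0 < α) (hα₂ : α < 1) :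
    (∀ x : ℝ, uFrac α x 0 = 1 + Real.sin x) ∧
    (∀ (x : ℝ) (t : ℝ), 0 < t →
      (1 / Real.Gamma (1 - α)) *
          ∫ ξ in (0:ℝ)..t, (t - ξ) ^ (-α) * deriv (fun τ => uFrac α x τ) ξ
        = deriv (deriv (fun y => uFrac α y t)) x + uFrac α x t) := by
  refine ⟨fun x => ?_, fun x t ht => ?_⟩
  · rw [uFrac, tsum_eq_single (0 : ℕ), add_comm]
    · simp
    · intro k hk
      rw [Real.zero_rpow (by positivity), zero_div]
  · have hxx : deriv (deriv fun y => uFrac α y t) x = -Real.sin x := by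
      have h1 : (deriv fun y => uFrac α y t) = Real.cos := by
        funext y
        exact ((Real.hasDerivAt_sin y).add_const _).deriv
      rw [h1, Real.deriv_cos]
    have hcongr : ∫ ξ in (0:ℝ)..t, (t - ξ) ^ (-α) * deriv (fun τ => uFrac α x τ) ξ
        = ∫ ξ in (0 : ℝ)..t, (t - ξ) ^ (-α) *
          ∑' n : ℕ, ξ ^ (((n + 1 : ℕ) : ℝ) * α - 1) / Real.Gamma (((n + 1 : ℕ) : ℝ) * α) := by
      simp only [intervalIntegral.integral_of_le ht.le]
      refine setIntegral_congr_fun measurableSet_Ioc fun ξ hξ => ?_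
      have hd : HasDerivAt (fun τ => uFrac α x τ) _ ξ :=
        (hasDerivAt_tsum_rpow_div_Gamma hα₁ hξ.1).const_add (Real.sin x)
      simp only [hd.deriv]
    have hG : Real.Gamma (1 - α) ≠ 0 := (Real.Gamma_pos_of_pos (by linarith)).ne'
    rw [hxx, hcongr, integral_sub_rpow_mul_tsum hα₁ hα₂ ht, uFrac]
    field_simp
    ring
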